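/- Let Z be a topological space and let U : ι → Set Z be a finite family of pairwise distinct, nonempty, connected open subsets of Z such that any two members of the family are either disjoint or comparable under inclusion (any two are disjoint or one is contained in the other). Then the indicator functions χ_{U i} : Z → ℤ are linearly independent over ℤ: if a : ι → ℤ and ∑ i, (a i) • χ_{U i} = 0 as a function Z → ℤ, then a i = 0 for all i. -/

import Mathlib

/-- χ_S, the indicator function of a set `S`, valued in `ℤ`. -/
noncomputable def chiInd {Z : Type*} (S : Set Z) : Z → ℤ := S.indicator fun _ => 1

/-- In a finite laminar family of nonempty open sets, a preconnected member is not covered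
by the members strictly contained in it. -/
theorem exists_mem_forall_ssubset_notMem {Z : Type*} [TopologicalSpace Z] {ι : Type*} [Finite ι]
    (U : ι → Set Z) (hopen : ∀ i, IsOpen (U i)) (hne : ∀ i, (U i).Nonempty)
    (hcomp : ∀ j k, j ≠ k → U j ∩ U k = ∅ ∨ U j ⊆ U k ∨ U k ⊆ U j)
    (i : ι) (hconn : IsPreconnected (U i)) :
    ∃ x ∈ U i, ∀ j, U j ⊂ U i → x ∉ U j := by
  by_contra! hcover
  obtain ⟨x, hx⟩ := hne i
  obtain ⟨j, hj, -⟩ := hcover x hx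
  obtain ⟨m, hm, hmax⟩ :=
    (Set.toFinite {j | U j ⊂ U i}).exists_maximalFor U _ ⟨j, hj⟩
  have hm' : U m ⊂ U i := hm
  obtain ⟨y, hyi, hym⟩ := Set.exists_of_ssubset hm'
  obtain ⟨z, hz⟩ := hne m
  let W : Set Z := ⋃ j ∈ {j | U j ⊂ U i ∧ ¬ U j ⊆ U m}, U j
  have hW : ∀ w ∈ U i, w ∉ U m → w ∈ W := by
    intro w hw hwm
    obtain ⟨k, hk, hwk⟩ := hcover w hw
    exact Set.mem_biUnion (show k ∈ {j | U j ⊂ U i ∧ ¬ U j ⊆ U m} from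
      ⟨hk, fun h => hwm (h hwk)⟩) hwk
  obtain ⟨w, -, hwm, hwW⟩ := hconn (U m) W (hopen m) (isOpen_biUnion fun k _ => hopen k)
    (fun w hw => or_iff_not_imp_left.2 (hW w hw)) ⟨z, hm'.1 hz, hz⟩ ⟨y, hyi, hW y hyi hym⟩
  obtain ⟨k, ⟨hk, hkm⟩, hwk⟩ := Set.mem_iUnion₂.1 hwW
  have hne' : k ≠ m := fun h => hkm (h ▸ subset_rfl)
  rcases hcomp k m hne' with h | h | h
  · exact Set.eq_empty_iff_forall_notMem.1 h w ⟨hwk, hwm⟩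
  · exact hkm h
  · exact hkm (hmax hk h)

theorem stmt2 {Z : Type*} [TopologicalSpace Z] {ι : Type*} [Fintype ι]
    (U : ι → Set Z) (hinj : Function.Injective U)
    (hopen : ∀ i, IsOpen (U i)) (hne : ∀ i, (U i).Nonempty)
    (hconn : ∀ i, IsPreconnected (U i))
    (hcomp : ∀ j k, j ≠ k → U j ∩ U k = ∅ ∨ U j ⊆ U k ∨ U k ⊆ U j)
    (a : ι → ℤ) (hsum : (∑ i, a i • chiInd (U i)) = 0) :
    ∀ i, a i = 0 := by
  by_contra! hnonzero
  obtain ⟨i, hi, hmax⟩ := (Set.toFinite {i | a i ≠ 0}).exists_maximalFor U _ hnonzero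
  obtain ⟨x, hx, hxU⟩ := exists_mem_forall_ssubset_notMem U hopen hne hcomp i (hconn i)
  have hsum_x : ∑ j, a j * chiInd (U j) x = 0 := by
    simpa [Finset.sum_apply] using congrFun hsum x
  rw [Finset.sum_eq_single i _ (by simp)] at hsum_x
  · exact hi (by simpa [chiInd, hx] using hsum_x)
  · intro j _ hji
    by_cases hxj : x ∈ U j
    · have haj : a j = 0 := by
        by_contra haj
        rcases hcomp j i hji with h | h | h
        · exact Set.eq_empty_iff_forall_notMem.1 h x ⟨hxj, hx⟩
        · exact hxU j (h.ssubset_of_ne (hinj.ne hji)) hxj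
        · exact hji (hinj ((hmax haj h).antisymm h))
      simp [haj]
    · simp [chiInd, hxj]
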